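/- arXiv:1902.06260 — 2 statements merged into one kernel-verified Lean document; each statement's English description precedes it below -/
import Mathlib

section
/- Let A be a split regular BiHom-Poisson superalgebra with maximal abelian graded subalgebra H and root system Λ. Then for any α, β ∈ Λ ∪ {0} and any ī, j̄ ∈ ℤ₂, the graded root spaces satisfy A_{α,ī} · A_{β,j̄} ⊆ A_{α∘φ⁻¹ + β∘ψ⁻¹, ī+j̄}, where A_{α,ī} := A_α ∩ A_ī. -/
/-- A (regular, with distinguished maximal abelian graded subalgebra `H`)
BiHom-Poisson superalgebra over a field `K`. -/
structure BHPS (K A : Type*) [Field K] [AddCommGroup A] [Module K A] where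
  /-- the ℤ₂-grading -/
  grade : ZMod 2 → Submodule K A
  gradeInternal : DirectSum.IsInternal grade
  /-- the bracket -/
  br : A →ₗ[K] A →ₗ[K] A
  /-- the associative-type product -/
  mu : A →ₗ[K] A →ₗ[K] A
  /-- the first structure map -/
  phi : A ≃ₗ[K] A
  /-- the second structure map -/
  psi : A ≃ₗ[K] A
  br_grade : ∀ (i j : ZMod 2), ∀ x ∈ grade i, ∀ y ∈ grade j, br x y ∈ grade (i + j)
  mu_grade : ∀ (i j : ZMod 2), ∀ x ∈ grade i, ∀ y ∈ grade j, mu x y ∈ grade (i + j)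
  phi_grade : ∀ i, (grade i).map (phi : A →ₗ[K] A) = grade i
  psi_grade : ∀ i, (grade i).map (psi : A →ₗ[K] A) = grade i
  phi_psi_comm : ∀ x, phi (psi x) = psi (phi x)
  phi_br : ∀ x y, phi (br x y) = br (phi x) (phi y)
  psi_br : ∀ x y, psi (br x y) = br (psi x) (psi y)
  phi_mu : ∀ x y, phi (mu x y) = mu (phi x) (phi y)
  psi_mu : ∀ x y, psi (mu x y) = mu (psi x) (psi y)
  skew : ∀ (i j : ZMod 2), ∀ x ∈ grade i, ∀ y ∈ grade j,
    br (psi x) (phi y) = -((-1 : K) ^ (i.val * j.val)) • br (psi y) (phi x)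
  jacobi : ∀ (i j k : ZMod 2), ∀ x ∈ grade i, ∀ y ∈ grade j, ∀ z ∈ grade k,
    ((-1 : K) ^ (i.val * k.val)) • br (psi (psi x)) (br (psi y) (phi z))
      + ((-1 : K) ^ (i.val * j.val)) • br (psi (psi y)) (br (psi z) (phi x))
      + ((-1 : K) ^ (j.val * k.val)) • br (psi (psi z)) (br (psi x) (phi y)) = 0
  assoc : ∀ x y z, mu (phi x) (mu y z) = mu (mu x y) (psi z)
  leibniz : ∀ (j k : ZMod 2), ∀ (x : A), ∀ y ∈ grade j, ∀ z ∈ grade k,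
    br (mu x y) (phi (psi z))
      = mu (phi x) (br y (phi z)) + ((-1 : K) ^ (j.val * k.val)) • mu (br x (psi z)) (phi y)
  /-- the maximal abelian graded subalgebra -/
  H : Submodule K A
  H_graded : H = (H ⊓ grade 0) ⊔ (H ⊓ grade 1)
  H_abelian : ∀ x ∈ H, ∀ y ∈ H, br x y = 0
  phi_H : H.map (phi : A →ₗ[K] A) = H
  psi_H : H.map (psi : A →ₗ[K] A) = H
  H_max : ∀ H' : Submodule K A, H ≤ H' →
    H' = (H' ⊓ grade 0) ⊔ (H' ⊓ grade 1) →
    (∀ x ∈ H', ∀ y ∈ H', br x y = 0) →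
    H'.map (phi : A →ₗ[K] A) = H' → H'.map (psi : A →ₗ[K] A) = H' → H' = H

namespace BHPS

variable {K A : Type*} [Field K] [AddCommGroup A] [Module K A] (D : BHPS K A)

/-- The even part `H₀` of `H`. -/
def H0 : Submodule K A := D.H ⊓ D.grade 0

lemma phi_H0 : D.H0.map (D.phi : A →ₗ[K] A) = D.H0 := by
  unfold H0
  rw [Submodule.map_inf (D.phi : A →ₗ[K] A) D.phi.injective, D.phi_H, D.phi_grade]

lemma psi_H0 : D.H0.map (D.psi : A →ₗ[K] A) = D.H0 := by
  unfold H0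
  rw [Submodule.map_inf (D.psi : A →ₗ[K] A) D.psi.injective, D.psi_H, D.psi_grade]

/-- The restriction of `φ` to `H₀`, as a linear automorphism. -/
def phiH0 : ↥D.H0 ≃ₗ[K] ↥D.H0 :=
  (D.phi.submoduleMap D.H0).trans (LinearEquiv.ofEq _ _ D.phi_H0)

/-- The restriction of `ψ` to `H₀`, as a linear automorphism. -/
def psiH0 : ↥D.H0 ≃ₗ[K] ↥D.H0 :=
  (D.psi.submoduleMap D.H0).trans (LinearEquiv.ofEq _ _ D.psi_H0)

/-- The root space attached to a linear functional `α : H₀ → K`: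
`A_α = {v : [h, φ(v)] = α(h) • φψ(v) for all h ∈ H₀}`. -/
def rootSpace (α : Module.Dual K ↥D.H0) : Submodule K A where
  carrier := {v | ∀ h : ↥D.H0, D.br (h : A) (D.phi v) = α h • D.phi (D.psi v)}
  add_mem' := by
    intro a b ha hb h
    simp only [map_add, ha h, hb h, smul_add]
  zero_mem' := by
    intro h
    simp
  smul_mem' := by
    intro c v hv h
    simp only [map_smul, hv h]
    rw [smul_comm]

/-- The root system `Λ`. -/
def roots : Set (Module.Dual K ↥D.H0) := {α | α ≠ 0 ∧ D.rootSpace α ≠ ⊥}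

/-- `A` is split with respect to `H`: `A = H ⊕ (⊕_{α ∈ Λ} A_α)`. -/
def IsSplit : Prop :=
  letI := Classical.decEq (Option ↥D.roots)
  DirectSum.IsInternal (fun o : Option ↥D.roots => o.elim D.H fun α => D.rootSpace α.1)

/-- `α ∘ φ^{z₁} ∘ ψ^{z₂}`. -/
def twist (z₁ z₂ : ℤ) (γ : Module.Dual K ↥D.H0) : Module.Dual K ↥D.H0 :=
  γ ∘ₗ ((((D.phiH0 ^ z₁) : ↥D.H0 ≃ₗ[K] ↥D.H0) : ↥D.H0 →ₗ[K] ↥D.H0) ∘ₗ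
        (((D.psiH0 ^ z₂) : ↥D.H0 ≃ₗ[K] ↥D.H0) : ↥D.H0 →ₗ[K] ↥D.H0))

/-- `±S = S ∪ (-S)`. -/
def pm (S : Set (Module.Dual K ↥D.H0)) : Set (Module.Dual K ↥D.H0) :=
  S ∪ (Neg.neg '' S)

/-- The partial sums `α₁∘φ^{-i} + α₂∘φ^{-i+1}∘ψ^{-1} + ⋯ + α_i∘φ^{-1}∘ψ^{-1} + α_{i+1}∘ψ^{-1}`
appearing in the definition of a connection. -/
def chainSum (a : ℕ → Module.Dual K ↥D.H0) (i : ℕ) : Module.Dual K ↥D.H0 :=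
  D.twist (-(i : ℤ)) 0 (a 1)
    + ∑ t ∈ Finset.Icc 2 (i + 1), D.twist (-((i : ℤ) + 1 - (t : ℤ))) (-1) (a t)

/-- `a 1, …, a k` is a connection from `α` to `β` (relative to the set of roots `S`). -/
def IsConnectionIn (S : Set (Module.Dual K ↥D.H0)) (α β : Module.Dual K ↥D.H0)
    (k : ℕ) (a : ℕ → Module.Dual K ↥D.H0) : Prop :=
  2 ≤ k ∧
  (∀ t, 1 ≤ t → t ≤ k → a t ∈ D.pm S) ∧
  (∃ n r : ℕ, a 1 = D.twist (-(n : ℤ)) (-(r : ℤ)) α) ∧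
  (∀ i, 1 ≤ i → i ≤ k - 2 → D.chainSum a i ∈ D.pm S) ∧
  (∃ m s : ℕ, D.chainSum a (k - 1) = D.twist (-(m : ℤ)) (-(s : ℤ)) β
      ∨ D.chainSum a (k - 1) = -(D.twist (-(m : ℤ)) (-(s : ℤ)) β))

/-- `α` is connected to `β` (relative to the set of roots `S`). -/
def ConnectedIn (S : Set (Module.Dual K ↥D.H0)) (α β : Module.Dual K ↥D.H0) : Prop :=
  (∃ z₁ z₂ : ℤ, ∃ ε : K, (ε = 1 ∨ ε = -1) ∧ β = ε • D.twist z₁ z₂ α) ∨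
  (∃ k a, D.IsConnectionIn S α β k a)

/-- `α` is connected to `β`. -/
def Connected (α β : Module.Dual K ↥D.H0) : Prop := D.ConnectedIn D.roots α β

/-- The set `[α]` of roots connected to `α`. -/
def classSet (α : Module.Dual K ↥D.H0) : Set (Module.Dual K ↥D.H0) :=
  {β ∈ D.roots | D.Connected α β}

/-- `I_{H,[α]} = span {[A_{β∘ψ⁻¹}, A_{−β∘φ⁻¹}] + A_{β∘ψ⁻¹}·A_{−β∘φ⁻¹} : β ∈ [α]}`. -/
def IH (α : Module.Dual K ↥D.H0) : Submodule K A :=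
  ⨆ β ∈ D.classSet α,
    (Submodule.map₂ D.br (D.rootSpace (D.twist 0 (-1) β)) (D.rootSpace (-(D.twist (-1) 0 β)))
      ⊔ Submodule.map₂ D.mu (D.rootSpace (D.twist 0 (-1) β)) (D.rootSpace (-(D.twist (-1) 0 β))))

/-- `V_{[α]} = ⊕_{β ∈ [α]} A_β`. -/
def VS (α : Module.Dual K ↥D.H0) : Submodule K A :=
  ⨆ β ∈ D.classSet α, D.rootSpace β

/-- `I_{[α]} = I_{H,[α]} ⊕ V_{[α]}`. -/
def Iclass (α : Module.Dual K ↥D.H0) : Submodule K A := D.IH α ⊔ D.VS α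

/-- `J` is an ideal of the (sub)algebra `I`. -/
def IsIdealIn (J I : Submodule K A) : Prop :=
  J ≤ I ∧ J = (J ⊓ D.grade 0) ⊔ (J ⊓ D.grade 1) ∧
  Submodule.map₂ D.br J I ≤ J ∧ Submodule.map₂ D.mu J I ≤ J ∧ Submodule.map₂ D.mu I J ≤ J ∧
  J.map (D.phi : A →ₗ[K] A) = J ∧ J.map (D.psi : A →ₗ[K] A) = J

/-- `I` is an ideal of `A`: `[I,A] + I·A + A·I ⊆ I`, graded and `φ,ψ`-invariant. -/
def IsIdeal (I : Submodule K A) : Prop := D.IsIdealIn I ⊤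

/-- `A` is simple: `[A,A] + A·A ≠ 0` and its only ideals are `0` and `A`. -/
def IsSimple : Prop :=
  (Submodule.map₂ D.br ⊤ ⊤ ⊔ Submodule.map₂ D.mu (⊤ : Submodule K A) ⊤ ≠ ⊥) ∧
  ∀ I : Submodule K A, D.IsIdeal I → I = ⊥ ∨ I = ⊤

/-- The center `Z(A) = {v : [v,A] + v·A + A·v = 0}`. -/
def center : Submodule K A where
  carrier := {v | ∀ w, D.br v w = 0 ∧ D.mu v w = 0 ∧ D.mu w v = 0}
  add_mem' := by
    intro a b ha hb w
    obtain ⟨h1, h2, h3⟩ := ha w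
    obtain ⟨g1, g2, g3⟩ := hb w
    simp [map_add, LinearMap.add_apply, h1, h2, h3, g1, g2, g3]
  zero_mem' := by intro w; simp
  smul_mem' := by
    intro c v hv w
    obtain ⟨h1, h2, h3⟩ := hv w
    simp [map_smul, LinearMap.smul_apply, h1, h2, h3]

/-- `Σ_{α∈Λ} ([A_{α∘ψ⁻¹}, A_{−α∘φ⁻¹}] + A_{α∘ψ⁻¹}·A_{−α∘φ⁻¹})`. -/
def HSum : Submodule K A :=
  ⨆ α ∈ D.roots,
    (Submodule.map₂ D.br (D.rootSpace (D.twist 0 (-1) α)) (D.rootSpace (-(D.twist (-1) 0 α)))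
      ⊔ Submodule.map₂ D.mu (D.rootSpace (D.twist 0 (-1) α)) (D.rootSpace (-(D.twist (-1) 0 α))))

/-- The root system is symmetric. -/
def IsSymmetric : Prop := ∀ α ∈ D.roots, -α ∈ D.roots

/-- `A` is root multiplicative. -/
def RootMultiplicative : Prop :=
  ∀ (i j : ZMod 2) (α β : Module.Dual K ↥D.H0), α ∈ D.roots → β ∈ D.roots →
    D.rootSpace α ⊓ D.grade i ≠ ⊥ → D.rootSpace β ⊓ D.grade j ≠ ⊥ →
    (D.twist 0 (-1) α + D.twist (-1) 0 β) ∈ D.roots →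
    D.rootSpace (D.twist 0 (-1) α + D.twist (-1) 0 β) ⊓ D.grade (i + j) ≠ ⊥ →
    Submodule.map₂ D.br (D.rootSpace α ⊓ D.grade i) (D.rootSpace β ⊓ D.grade j)
      ⊔ Submodule.map₂ D.mu (D.rootSpace α ⊓ D.grade i) (D.rootSpace β ⊓ D.grade j) ≠ ⊥

/-- `A` is of maximal length: every nonzero graded root space is one-dimensional. -/
def MaximalLength : Prop :=
  ∀ (i : ZMod 2), ∀ α ∈ D.roots, D.rootSpace α ⊓ D.grade i ≠ ⊥ →
    Module.rank K ↥(D.rootSpace α ⊓ D.grade i) = 1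

end BHPS

namespace BHPS

section

variable {K A : Type*} [Field K] [AddCommGroup A] [Module K A] (D : BHPS K A)

@[simp]
lemma coe_phiH0 (h : ↥D.H0) : (D.phiH0 h : A) = D.phi h := rfl

@[simp]
lemma coe_psiH0 (h : ↥D.H0) : (D.psiH0 h : A) = D.psi h := rfl

lemma twist_neg_one_zero_apply (γ : Module.Dual K ↥D.H0) (h : ↥D.H0) :
    D.twist (-1) 0 γ h = γ (D.phiH0.symm h) := by
  simp only [twist, zpow_neg_one, zpow_zero]
  rfl

lemma twist_zero_neg_one_apply (γ : Module.Dual K ↥D.H0) (h : ↥D.H0) :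
    D.twist 0 (-1) γ h = γ (D.psiH0.symm h) := by
  simp only [twist, zpow_neg_one, zpow_zero]
  rfl

lemma psi_mem_grade {i : ZMod 2} {x : A} (hx : x ∈ D.grade i) : D.psi x ∈ D.grade i := by
  rw [← D.psi_grade i]
  exact Submodule.mem_map_of_mem hx

lemma br_psi_phi_of_mem_H0 {j : ZMod 2} {v : A} (hv : v ∈ D.grade j) (h : ↥D.H0) :
    D.br (D.psi h) (D.phi v) = -D.br (D.psi v) (D.phi h) := by
  simpa using D.skew 0 j h h.2.2 v hv

lemma br_psi_phi_of_mem_rootSpace {j : ZMod 2} {γ : Module.Dual K ↥D.H0} {v : A}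
    (hγ : v ∈ D.rootSpace γ) (hv : v ∈ D.grade j) (h : ↥D.H0) :
    D.br (D.psi v) (D.phi h) = -(γ (D.psiH0 h) • D.phi (D.psi v)) := by
  rw [← hγ (D.psiH0 h), coe_psiH0, D.br_psi_phi_of_mem_H0 hv h, neg_neg]

lemma mu_mem_rootSpace {i j : ZMod 2} {α β : Module.Dual K ↥D.H0} {x y : A}
    (hxα : x ∈ D.rootSpace α) (hx : x ∈ D.grade i)
    (hyβ : y ∈ D.rootSpace β) (hy : y ∈ D.grade j) :
    D.mu x y ∈ D.rootSpace (D.twist (-1) 0 α + D.twist 0 (-1) β) := by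
  intro h
  obtain ⟨z, rfl⟩ : ∃ z, D.psiH0 (D.psiH0 z) = h :=
    ⟨D.psiH0.symm (D.psiH0.symm h), by simp⟩
  obtain ⟨w, hw⟩ := D.phiH0.surjective (D.psiH0 z)
  have hw' : D.phi w = D.psi z := congrArg Subtype.val hw
  have hpw : D.phiH0.symm (D.psiH0 (D.psiH0 z)) = D.psiH0 w := by
    rw [LinearEquiv.symm_apply_eq, ← hw]
    exact Subtype.ext (D.phi_psi_comm w).symm
  have hbr : D.br (D.psi (D.mu x y)) (D.phi (D.psi z))
      = -((α (D.psiH0 w) + β (D.psiH0 z)) • D.phi (D.psi (D.mu x y))) := by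
    rw [D.psi_mu, D.leibniz j 0 (D.psi x) (D.psi y) (D.psi_mem_grade hy) z z.2.2, ← hw',
      D.br_psi_phi_of_mem_rootSpace hyβ hy, D.br_psi_phi_of_mem_rootSpace hxα hx, D.phi_mu]
    simp only [ZMod.val_zero, mul_zero, pow_zero, one_smul, map_neg, map_smul,
      LinearMap.neg_apply, LinearMap.smul_apply, add_smul]
    abel
  rw [LinearMap.add_apply, twist_neg_one_zero_apply, twist_zero_neg_one_apply, hpw,
    LinearEquiv.symm_apply_apply, coe_psiH0, D.br_psi_phi_of_mem_H0 (D.mu_grade i j x hx y hy),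
    coe_psiH0, hbr, neg_neg]

end

variable {K A : Type*}

/-- `A_{α,ī} · A_{β,j̄} ⊆ A_{α∘φ⁻¹ + β∘ψ⁻¹, ī+j̄}`. -/
theorem graded_rootSpace_mul {K A : Type*} [Field K] [AddCommGroup A] [Module K A] (D : BHPS K A)
    (hsplit : D.IsSplit)
    (α β : Module.Dual K ↥D.H0)
    (hα : α ∈ D.roots ∨ α = 0) (hβ : β ∈ D.roots ∨ β = 0) (i j : ZMod 2) :
    Submodule.map₂ D.mu (D.rootSpace α ⊓ D.grade i) (D.rootSpace β ⊓ D.grade j)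
      ≤ D.rootSpace (D.twist (-1) 0 α + D.twist 0 (-1) β) ⊓ D.grade (i + j) := by
  rw [Submodule.map₂_le]
  rintro x ⟨hxα, hx⟩ y ⟨hyβ, hy⟩
  exact ⟨D.mu_mem_rootSpace hxα hx hyβ hy, D.mu_grade i j x hx y hy⟩

end BHPS
end

section
/- Let A be a split regular BiHom-Poisson superalgebra with root system Λ, and let [α] ∈ Λ/∼. Then I_{[α]} is invariant under the structure maps: φ(I_{[α]}) = I_{[α]} and ψ(I_{[α]}) = I_{[α]}. -/
namespace BHPS

variable {K A : Type*}

section Twist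

variable [Field K] [AddCommGroup A] [Module K A] (D : BHPS K A)

lemma phiH0_psiH0_commute : Commute D.phiH0 D.psiH0 := by
  ext h
  exact D.phi_psi_comm h

lemma twist_apply (z₁ z₂ : ℤ) (γ : Module.Dual K ↥D.H0) (h : ↥D.H0) :
    D.twist z₁ z₂ γ h = γ ((D.phiH0 ^ z₁ * D.psiH0 ^ z₂) h) := rfl

lemma twist_twist (z₁ z₂ w₁ w₂ : ℤ) (γ : Module.Dual K ↥D.H0) :
    D.twist z₁ z₂ (D.twist w₁ w₂ γ) = D.twist (z₁ + w₁) (z₂ + w₂) γ := by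
  ext h
  rw [twist_apply, twist_apply, twist_apply, ← LinearEquiv.mul_apply]
  congr 2
  rw [add_comm z₁, add_comm z₂, zpow_add, zpow_add, mul_assoc, mul_assoc,
    ← mul_assoc (D.psiH0 ^ w₂), ← mul_assoc (D.phiH0 ^ z₁),
    (D.phiH0_psiH0_commute.zpow_zpow z₁ w₂).eq]

lemma twist_zero (γ : Module.Dual K ↥D.H0) : D.twist 0 0 γ = γ := by
  ext h
  simp [twist_apply]

lemma twist_add (z₁ z₂ : ℤ) (γ δ : Module.Dual K ↥D.H0) :
    D.twist z₁ z₂ (γ + δ) = D.twist z₁ z₂ γ + D.twist z₁ z₂ δ := rfl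

lemma twist_neg (z₁ z₂ : ℤ) (γ : Module.Dual K ↥D.H0) :
    D.twist z₁ z₂ (-γ) = -D.twist z₁ z₂ γ := rfl

lemma twist_smul (z₁ z₂ : ℤ) (c : K) (γ : Module.Dual K ↥D.H0) :
    D.twist z₁ z₂ (c • γ) = c • D.twist z₁ z₂ γ := rfl

lemma twist_sum {ι : Type*} (z₁ z₂ : ℤ) (s : Finset ι) (f : ι → Module.Dual K ↥D.H0) :
    D.twist z₁ z₂ (∑ i ∈ s, f i) = ∑ i ∈ s, D.twist z₁ z₂ (f i) := by
  ext h
  simp [twist_apply]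

lemma twist_comm (z₁ z₂ w₁ w₂ : ℤ) (γ : Module.Dual K ↥D.H0) :
    D.twist z₁ z₂ (D.twist w₁ w₂ γ) = D.twist w₁ w₂ (D.twist z₁ z₂ γ) := by
  rw [twist_twist, twist_twist, add_comm z₁, add_comm z₂]

/-- Twisting by `φ^{z₁} ∘ ψ^{z₂}` as a permutation of the dual of `H₀`. -/
def twistEquiv (z₁ z₂ : ℤ) : Module.Dual K ↥D.H0 ≃ Module.Dual K ↥D.H0 where
  toFun := D.twist z₁ z₂
  invFun := D.twist (-z₁) (-z₂)
  left_inv γ := by simp [twist_twist, twist_zero]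
  right_inv γ := by simp [twist_twist, twist_zero]

lemma twistEquiv_apply (z₁ z₂ : ℤ) (γ : Module.Dual K ↥D.H0) :
    D.twistEquiv z₁ z₂ γ = D.twist z₁ z₂ γ := rfl

lemma chainSum_twist (z₁ z₂ : ℤ) (a : ℕ → Module.Dual K ↥D.H0) (i : ℕ) :
    D.chainSum (fun t => D.twist z₁ z₂ (a t)) i = D.twist z₁ z₂ (D.chainSum a i) := by
  simp only [chainSum, twist_add, twist_sum, D.twist_comm z₁ z₂]

lemma phi_phiH0_inv (h : ↥D.H0) : D.phi (D.phiH0⁻¹ h : ↥D.H0) = h :=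
  congrArg Subtype.val (D.phiH0.apply_symm_apply h)

lemma psi_psiH0_inv (h : ↥D.H0) : D.psi (D.psiH0⁻¹ h : ↥D.H0) = h :=
  congrArg Subtype.val (D.psiH0.apply_symm_apply h)

lemma mem_rootSpace {γ : Module.Dual K ↥D.H0} {v : A} :
    v ∈ D.rootSpace γ ↔ ∀ h : ↥D.H0, D.br (h : A) (D.phi v) = γ h • D.phi (D.psi v) := Iff.rfl

lemma map_phi_rootSpace (γ : Module.Dual K ↥D.H0) :
    (D.rootSpace γ).map (D.phi : A →ₗ[K] A) = D.rootSpace (D.twist (-1) 0 γ) := by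
  ext w
  obtain ⟨v, rfl⟩ := D.phi.surjective w
  rw [Submodule.mem_map_equiv, D.phi.symm_apply_apply, mem_rootSpace, mem_rootSpace,
    ← (D.phiH0⁻¹).toEquiv.forall_congr_right]
  refine forall_congr' fun h => ?_
  rw [← D.phi.injective.eq_iff, D.phi_br, map_smul, D.phi_psi_comm v]
  simp only [LinearEquiv.coe_toEquiv, phi_phiH0_inv, twist_apply, zpow_neg_one, zpow_zero,
    mul_one]

lemma map_psi_rootSpace (γ : Module.Dual K ↥D.H0) :
    (D.rootSpace γ).map (D.psi : A →ₗ[K] A) = D.rootSpace (D.twist 0 (-1) γ) := by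
  ext w
  obtain ⟨v, rfl⟩ := D.psi.surjective w
  rw [Submodule.mem_map_equiv, D.psi.symm_apply_apply, mem_rootSpace, mem_rootSpace,
    ← (D.psiH0⁻¹).toEquiv.forall_congr_right]
  refine forall_congr' fun h => ?_
  rw [← D.psi.injective.eq_iff, D.psi_br, map_smul, ← D.phi_psi_comm v,
    ← D.phi_psi_comm (D.psi v)]
  simp only [LinearEquiv.coe_toEquiv, psi_psiH0_inv, twist_apply, zpow_neg_one, zpow_zero,
    one_mul]

end Twist

section Invariance

variable [Field K] [AddCommGroup A] [Module K A] {D : BHPS K A}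

lemma twist_mem_roots_iff {e : A ≃ₗ[K] A} {z₁ z₂ : ℤ}
    (he : ∀ γ, (D.rootSpace γ).map (e : A →ₗ[K] A) = D.rootSpace (D.twist z₁ z₂ γ))
    (γ : Module.Dual K ↥D.H0) : D.twist z₁ z₂ γ ∈ D.roots ↔ γ ∈ D.roots := by
  refine and_congr (not_congr ?_) (not_congr ?_)
  · exact (D.twistEquiv z₁ z₂).injective.eq_iff' rfl
  · rw [← he, Submodule.map_eq_bot_iff]

lemma twist_mem_pm_roots {z₁ z₂ : ℤ}
    (hroots : ∀ γ, D.twist z₁ z₂ γ ∈ D.roots ↔ γ ∈ D.roots)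
    {γ : Module.Dual K ↥D.H0} (hγ : γ ∈ D.pm D.roots) : D.twist z₁ z₂ γ ∈ D.pm D.roots := by
  rcases hγ with hγ | ⟨δ, hδ, rfl⟩
  · exact Or.inl ((hroots γ).2 hγ)
  · exact Or.inr ⟨_, (hroots δ).2 hδ, rfl⟩

lemma twist_mem_classSet_iff {n r : ℕ}
    (hroots : ∀ γ, D.twist (-(n : ℤ)) (-(r : ℤ)) γ ∈ D.roots ↔ γ ∈ D.roots)
    (α γ : Module.Dual K ↥D.H0) :
    D.twist (-(n : ℤ)) (-(r : ℤ)) γ ∈ D.classSet α ↔ γ ∈ D.classSet α := by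
  refine and_congr (hroots γ) ⟨?_, ?_⟩
  · rintro (⟨z₁, z₂, ε, hε, h⟩ | ⟨k, a, hk, ha, h₁, hsum, m, s, hend⟩)
    · refine Or.inl ⟨n + z₁, r + z₂, ε, hε, ?_⟩
      rw [← twist_twist, ← twist_smul, ← h, twist_twist, add_neg_cancel, add_neg_cancel,
        twist_zero]
    · refine Or.inr ⟨k, a, hk, ha, h₁, hsum, m + n, s + r, ?_⟩
      rwa [Nat.cast_add, Nat.cast_add, neg_add, neg_add, ← twist_twist]
  · rintro (⟨z₁, z₂, ε, hε, rfl⟩ | ⟨k, a, hk, ha, ⟨p, q, h₁⟩, hsum, m, s, hend⟩)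
    · refine Or.inl ⟨-n + z₁, -r + z₂, ε, hε, ?_⟩
      rw [← twist_twist, twist_smul]
    · refine Or.inr ⟨k, fun t => D.twist (-(n : ℤ)) (-(r : ℤ)) (a t), hk,
        fun t h h' => twist_mem_pm_roots hroots (ha t h h'), ⟨n + p, r + q, ?_⟩, ?_, m, s, ?_⟩
      · beta_reduce
        rw [h₁, twist_twist, Nat.cast_add, Nat.cast_add, neg_add, neg_add]
      · intro i h h'
        rw [chainSum_twist]
        exact twist_mem_pm_roots hroots (hsum i h h')
      · rw [chainSum_twist, D.twist_comm (-(m : ℤ))]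
        exact hend.imp (congrArg _) (congrArg _)

lemma map_equiv_map₂ {e : A ≃ₗ[K] A} {f : A →ₗ[K] A →ₗ[K] A}
    (hf : ∀ x y, e (f x y) = f (e x) (e y)) (p q : Submodule K A) :
    (Submodule.map₂ f p q).map (e : A →ₗ[K] A)
      = Submodule.map₂ f (p.map (e : A →ₗ[K] A)) (q.map (e : A →ₗ[K] A)) := by
  rw [Submodule.map_map₂, Submodule.map₂_map_map]
  congr 1
  ext x y
  exact hf x y

lemma map_Iclass {e : A ≃ₗ[K] A} {n r : ℕ}
    (hbr : ∀ x y, e (D.br x y) = D.br (e x) (e y)) (hmu : ∀ x y, e (D.mu x y) = D.mu (e x) (e y))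
    (he : ∀ γ, (D.rootSpace γ).map (e : A →ₗ[K] A)
      = D.rootSpace (D.twist (-(n : ℤ)) (-(r : ℤ)) γ))
    (α : Module.Dual K ↥D.H0) :
    (D.Iclass α).map (e : A →ₗ[K] A) = D.Iclass α := by
  have hmem := twist_mem_classSet_iff (twist_mem_roots_iff he) α
  have hVS : (D.VS α).map (e : A →ₗ[K] A) = D.VS α := by
    simp only [VS, Submodule.map_iSup, he]
    refine (D.twistEquiv (-(n : ℤ)) (-(r : ℤ))).iSup_congr fun γ => ?_
    rw [twistEquiv_apply, iSup_congr_Prop (hmem γ) fun _ => rfl]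
  have hIH : (D.IH α).map (e : A →ₗ[K] A) = D.IH α := by
    simp only [IH, Submodule.map_iSup, Submodule.map_sup, map_equiv_map₂ hbr,
      map_equiv_map₂ hmu, he, twist_neg, D.twist_comm (-(n : ℤ))]
    refine (D.twistEquiv (-(n : ℤ)) (-(r : ℤ))).iSup_congr fun γ => ?_
    rw [twistEquiv_apply, iSup_congr_Prop (hmem γ) fun _ => rfl]
  rw [Iclass, Submodule.map_sup, hIH, hVS]

end Invariance

/-- `φ(I_{[α]}) = I_{[α]}` and `ψ(I_{[α]}) = I_{[α]}`. -/
theorem Iclass_invariant {K A : Type*} [Field K] [AddCommGroup A] [Module K A] (D : BHPS K A)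
    (hsplit : D.IsSplit)
    (α : Module.Dual K ↥D.H0) (hα : α ∈ D.roots) :
    (D.Iclass α).map (D.phi : A →ₗ[K] A) = D.Iclass α ∧
    (D.Iclass α).map (D.psi : A →ₗ[K] A) = D.Iclass α := by
  exact ⟨map_Iclass (n := 1) (r := 0) D.phi_br D.phi_mu D.map_phi_rootSpace α,
    map_Iclass (n := 0) (r := 1) D.psi_br D.psi_mu D.map_psi_rootSpace α⟩

end BHPS
end
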